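/- For every integer g ≥ 3 and every k ∈ K_g, the tree T_k is balanced, and the map k ↦ T_k is a bijection from K_g onto the set T_g^b of balanced trees. In particular, for every balanced tree T ∈ T_g^b there is a unique k ∈ K_g with T isomorphic to T_k by an isomorphism preserving the leaf labels. -/

import Mathlib

/-- `IsHier g F` encodes (up to label-preserving isomorphism) a tree in `T_g`, i.e. a tree with
`g` leaves labeled `1, …, g` and all other vertices of degree `3`, rooted at the leaf `g`, by
the family `F` of descendant-leaf sets `S(v) ⊆ {1, …, g-1}` of its `g - 2` internal vertices. -/
def IsHier (g : ℕ) (F : Finset (Finset ℕ)) : Prop :=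
  (∀ A ∈ F, A ⊆ Finset.Icc 1 (g - 1)) ∧
  (∀ A ∈ F, 2 ≤ A.card) ∧
  Finset.Icc 1 (g - 1) ∈ F ∧
  (∀ A ∈ F, ∀ B ∈ F, A ⊆ B ∨ B ⊆ A ∨ Disjoint A B) ∧
  F.card = g - 2

/-- In the hierarchy encoding, an internal vertex with descendant-leaf set `A` is balanced iff
no descendant-leaf set `B ⊂ A` of another internal vertex contains both of the two smallest
labels of `A` (equivalently, the paths from the vertex to the two descendant leaves with the two
smallest labels have no common edge).  The tree is balanced if all internal vertices are. -/
def BalancedFam (F : Finset (Finset ℕ)) : Prop :=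
  ∀ A ∈ F, ∀ l₁ l₂ : ℕ, l₁ ∈ A → l₂ ∈ A → l₁ < l₂ →
    (∀ m ∈ A, m = l₁ ∨ l₂ ≤ m) →
    ¬ ∃ B ∈ F, B ⊂ A ∧ l₁ ∈ B ∧ l₂ ∈ B

/-- `K_g`: sequences `k = (k_1, …, k_{g-2})` with `1 ≤ k_i ≤ i`, encoded as functions
`ℕ → ℕ` vanishing outside `{1, …, g-2}`. -/
def KSet (g : ℕ) : Set (ℕ → ℕ) :=
  {k | (∀ i, 1 ≤ i → i ≤ g - 2 → 1 ≤ k i ∧ k i ≤ i) ∧ (∀ i, i = 0 ∨ g - 2 < i → k i = 0)}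

/-- `buildSet k j s` is the descendant-leaf set of the internal vertex `u_j` of the tree
`T_{(k_1, …, k_{j+s})}`: it starts as `{k_j, j+1}` (the vertex created at step `j`) and at each
later step `t = j + s' + 1` the new leaf `t + 1` is adjoined iff `k_t` already lies in the set. -/
def buildSet (k : ℕ → ℕ) (j : ℕ) : ℕ → Finset ℕ
  | 0 => {k j, j + 1}
  | s + 1 =>
      if k (j + s + 1) ∈ buildSet k j s then insert (j + s + 2) (buildSet k j s)
      else buildSet k j s

/-- The tree `T_k ∈ T_g` associated to `k ∈ K_g`, encoded as the hierarchy of the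
descendant-leaf sets of its internal vertices `u_1, …, u_{g-2}`. -/
def treeFam (g : ℕ) (k : ℕ → ℕ) : Finset (Finset ℕ) :=
  (Finset.Icc 1 (g - 2)).image (fun j => buildSet k j (g - 2 - j))

def Lam (F : Finset (Finset ℕ)) : Prop := ∀ A ∈ F, ∀ B ∈ F, A ⊆ B ∨ B ⊆ A ∨ Disjoint A B

lemma lam_cases {F : Finset (Finset ℕ)} (h : Lam F) {A B : Finset ℕ} (hA : A ∈ F) (hB : B ∈ F)
    {x : ℕ} (hx : x ∈ A) (hx' : x ∈ B) : A ⊆ B ∨ B ⊆ A := by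
  rcases h A hA B hB with h | h | h
  · exact Or.inl h
  · exact Or.inr h
  · exact absurd hx' (Finset.disjoint_left.mp h hx)

lemma exists_min {F : Finset (Finset ℕ)} (h : Lam F) {m : ℕ} (hm : ∃ A ∈ F, m ∈ A) :
    ∃ A ∈ F, m ∈ A ∧ ∀ B ∈ F, m ∈ B → A ⊆ B := by
  obtain ⟨A, hA, hmin⟩ := Finset.exists_min_image (F.filter (fun A => m ∈ A)) Finset.card
    (by obtain ⟨A, hA, hm⟩ := hm; exact ⟨A, by simp [hA, hm]⟩)
  simp only [Finset.mem_filter] at hA hmin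
  refine ⟨A, hA.1, hA.2, fun B hB hmB => ?_⟩
  rcases lam_cases h hA.1 hB hA.2 hmB with h1 | h1
  · exact h1
  · rw [Finset.eq_of_subset_of_card_le h1 (hmin B ⟨hB, hmB⟩)]

lemma two_small {A : Finset ℕ} (h : 2 ≤ A.card) :
    ∃ l₁ ∈ A, ∃ l₂ ∈ A, l₁ < l₂ ∧ ∀ m ∈ A, m = l₁ ∨ l₂ ≤ m := by
  have h1 : A.Nonempty := Finset.card_pos.mp (by omega)
  have h2 : (A.erase (A.min' h1)).Nonempty := Finset.card_pos.mp (by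
    rw [Finset.card_erase_of_mem (A.min'_mem h1)]; omega)
  have h3 := Finset.min'_mem _ h2
  refine ⟨A.min' h1, A.min'_mem h1, (A.erase (A.min' h1)).min' h2, Finset.mem_of_mem_erase h3,
    ?_, ?_⟩
  · exact lt_of_le_of_ne (A.min'_le _ (Finset.mem_of_mem_erase h3)) (Finset.ne_of_mem_erase h3).symm
  · intro m hm
    by_cases e : m = A.min' h1
    · exact Or.inl e
    · exact Or.inr (Finset.min'_le _ _ (Finset.mem_erase.mpr ⟨e, hm⟩))

def restr (m : ℕ) (A0 : Finset ℕ) (F : Finset (Finset ℕ)) : Finset (Finset ℕ) :=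
  (F.erase A0).image (fun A => A.erase m)

lemma restr_inj_aux {F : Finset (Finset ℕ)} (h : Lam F) (h2 : ∀ A ∈ F, 2 ≤ A.card) {m : ℕ}
    {A0 : Finset ℕ} (hA0 : A0 ∈ F) (hm : m ∈ A0) (hmin : ∀ B ∈ F, m ∈ B → A0 ⊆ B)
    {B C : Finset ℕ} (hB : B ∈ F) (hC : C ∈ F) (hB0 : B ≠ A0)
    (hmB : m ∈ B) (hmC : m ∉ C) (e : B.erase m = C.erase m) : False := by
  have hBC : B = insert m C := by
    rw [← Finset.insert_erase hmB, e, Finset.erase_eq_of_notMem hmC]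
  have hs := hmin B hB hmB
  rcases h A0 hA0 C hC with h1 | h1 | h1
  · exact hmC (h1 hm)
  · apply hB0
    apply Finset.Subset.antisymm _ hs
    rw [hBC]
    exact Finset.insert_subset hm h1
  · have : A0 ⊆ {m} := by
      intro x hx
      have := hs hx
      rw [hBC, Finset.mem_insert] at this
      rcases this with h3 | h3
      · simp [h3]
      · exact absurd h3 (Finset.disjoint_left.mp h1 hx)
    have := Finset.card_le_card this
    have := h2 A0 hA0
    simp at *
    omega

lemma restr_card {F : Finset (Finset ℕ)} (h : Lam F) (h2 : ∀ A ∈ F, 2 ≤ A.card) {m : ℕ}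
    {A0 : Finset ℕ} (hA0 : A0 ∈ F) (hm : m ∈ A0) (hmin : ∀ B ∈ F, m ∈ B → A0 ⊆ B) :
    (restr m A0 F).card = F.card - 1 := by
  rw [restr, Finset.card_image_of_injOn, Finset.card_erase_of_mem hA0]
  intro B hB C hC e
  simp only [Finset.coe_erase, Set.mem_sdiff, Finset.mem_coe, Set.mem_singleton_iff] at hB hC
  simp only at e
  by_cases hmB : m ∈ B <;> by_cases hmC : m ∈ C
  · rw [← Finset.insert_erase hmB, e, Finset.insert_erase hmC]
  · exact (restr_inj_aux h h2 hA0 hm hmin hB.1 hC.1 hB.2 hmB hmC e).elim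
  · exact (restr_inj_aux h h2 hA0 hm hmin hC.1 hB.1 hC.2 hmC hmB e.symm).elim
  · rwa [Finset.erase_eq_of_notMem hmB, Finset.erase_eq_of_notMem hmC] at e

lemma restr_lam {F : Finset (Finset ℕ)} (h : Lam F) (m : ℕ) (A0 : Finset ℕ) :
    Lam (restr m A0 F) := by
  intro A hA B hB
  simp only [restr, Finset.mem_image, Finset.mem_erase] at hA hB
  obtain ⟨A, ⟨-, hA⟩, rfl⟩ := hA
  obtain ⟨B, ⟨-, hB⟩, rfl⟩ := hB
  rcases h A hA B hB with h1 | h1 | h1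
  · exact Or.inl (Finset.erase_subset_erase _ h1)
  · exact Or.inr (Or.inl (Finset.erase_subset_erase _ h1))
  · exact Or.inr (Or.inr (Finset.disjoint_of_subset_left (Finset.erase_subset _ _)
      (Finset.disjoint_of_subset_right (Finset.erase_subset _ _) h1)))

lemma restr_two {F : Finset (Finset ℕ)} (h2 : ∀ A ∈ F, 2 ≤ A.card) {m : ℕ}
    {A0 : Finset ℕ} (hA0 : A0 ∈ F) (hmin : ∀ B ∈ F, m ∈ B → A0 ⊆ B) :
    ∀ A ∈ restr m A0 F, 2 ≤ A.card := by
  intro A hA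
  simp only [restr, Finset.mem_image, Finset.mem_erase] at hA
  obtain ⟨A, ⟨hne, hA⟩, rfl⟩ := hA
  by_cases hmA : m ∈ A
  · have := Finset.card_lt_card (Finset.ssubset_iff_subset_ne.mpr ⟨hmin A hA hmA, hne.symm⟩)
    have := h2 A0 hA0
    rw [Finset.card_erase_of_mem hmA]
    omega
  · rw [Finset.erase_eq_of_notMem hmA]; exact h2 A hA

lemma sub_erase {n : ℕ} {A : Finset ℕ} (h : A ⊆ Finset.Icc 1 (n + 1)) :
    A.erase (n + 1) ⊆ Finset.Icc 1 n := by
  intro x hx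
  rw [Finset.mem_erase] at hx
  have := h hx.2
  rw [Finset.mem_Icc] at *
  omega

lemma restr_sub {F : Finset (Finset ℕ)} {n : ℕ} (hs : ∀ A ∈ F, A ⊆ Finset.Icc 1 (n + 1))
    (A0 : Finset ℕ) : ∀ A ∈ restr (n + 1) A0 F, A ⊆ Finset.Icc 1 n := by
  intro A hA
  simp only [restr, Finset.mem_image, Finset.mem_erase] at hA
  obtain ⟨A, ⟨-, hA⟩, rfl⟩ := hA
  exact sub_erase (hs A hA)

lemma lam_bound (n : ℕ) : ∀ F : Finset (Finset ℕ), Lam F → (∀ A ∈ F, 2 ≤ A.card) →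
    (∀ A ∈ F, A ⊆ Finset.Icc 1 (n + 1)) → F.card ≤ n := by
  induction n with
  | zero =>
    intro F _ h2 hs
    rw [Nat.le_zero, Finset.card_eq_zero, Finset.eq_empty_iff_forall_notMem]
    intro A hA
    have := Finset.card_le_card (hs A hA)
    have := h2 A hA
    simp at *
    omega
  | succ n ih =>
    intro F h h2 hs
    by_cases hm : ∃ A ∈ F, (n + 1 + 1) ∈ A
    · obtain ⟨A0, hA0, hm, hmin⟩ := exists_min h hm
      have := ih (restr (n + 1 + 1) A0 F) (restr_lam h _ _) (restr_two h2 hA0 hmin)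
        (restr_sub hs A0)
      rw [restr_card h h2 hA0 hm hmin] at this
      omega
    · push Not at hm
      refine (ih F h h2 fun A hA => ?_).trans (Nat.le_succ n)
      have := sub_erase (hs A hA)
      rwa [Finset.erase_eq_of_notMem (hm A hA)] at this

def lift1 (m c : ℕ) (A : Finset ℕ) : Finset ℕ := if c ∈ A then insert m A else A

def extF (m c : ℕ) (F : Finset (Finset ℕ)) : Finset (Finset ℕ) :=
  insert {c, m} (F.image (lift1 m c))

lemma treeFam_succ (n : ℕ) (k : ℕ → ℕ) :
    treeFam (n + 1 + 2) k = extF (n + 2) (k (n + 1)) (treeFam (n + 2) k) := by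
  unfold treeFam extF
  simp only [Nat.add_sub_cancel]
  rw [← Finset.insert_Icc_right_eq_Icc_add_one (by omega), Finset.image_insert, Finset.image_image]
  congr 1
  · simp [buildSet]
  · apply Finset.image_congr
    intro j hj
    simp only [Finset.coe_Icc, Set.mem_Icc] at hj
    obtain ⟨s, rfl⟩ := Nat.exists_eq_add_of_le hj.2
    have e : j + s + 1 - j = s + 1 := by omega
    have e' : j + s - j = s := by omega
    simp only [Function.comp, e, e', buildSet, lift1]

lemma buildSet_congr {k l : ℕ → ℕ} (j s : ℕ) (h : ∀ i ≤ j + s, k i = l i) :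
    buildSet k j s = buildSet l j s := by
  induction s with
  | zero => simp [buildSet, h j (by omega)]
  | succ s ih =>
    simp only [buildSet]
    rw [ih (fun i hi => h i (by omega)), h (j + s + 1) (by omega)]

lemma treeFam_congr {k l : ℕ → ℕ} (n : ℕ) (h : ∀ i ≤ n, k i = l i) :
    treeFam (n + 2) k = treeFam (n + 2) l := by
  unfold treeFam
  apply Finset.image_congr
  intro j hj
  simp only [Finset.coe_Icc, Set.mem_Icc] at hj
  exact buildSet_congr _ _ (fun i hi => h i (by omega))

structure Hier (n : ℕ) (F : Finset (Finset ℕ)) : Prop where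
  sub : ∀ A ∈ F, A ⊆ Finset.Icc 1 (n + 1)
  two : ∀ A ∈ F, 2 ≤ A.card
  top : Finset.Icc 1 (n + 1) ∈ F
  lam : Lam F
  card : F.card = n

lemma hier_iff (n : ℕ) (F : Finset (Finset ℕ)) : IsHier (n + 2) F ↔ Hier n F :=
  ⟨fun ⟨a, b, c, d, e⟩ => ⟨a, b, c, d, e⟩, fun ⟨a, b, c, d, e⟩ => ⟨a, b, c, d, e⟩⟩

section ext
variable {n c : ℕ} {F : Finset (Finset ℕ)}

lemma Hier.notMem (h : Hier n F) {A : Finset ℕ} (hA : A ∈ F) : n + 2 ∉ A := fun hm => by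
  have := Finset.mem_Icc.mp (h.sub A hA hm); omega

lemma lift_erase {m : ℕ} {A : Finset ℕ} (hm : m ∉ A) : (lift1 m c A).erase m = A := by
  unfold lift1; split_ifs
  · exact Finset.erase_insert hm
  · exact Finset.erase_eq_of_notMem hm

lemma mem_lift {m x : ℕ} {A : Finset ℕ} : x ∈ lift1 m c A ↔ x ∈ A ∨ (x = m ∧ c ∈ A) := by
  unfold lift1; split_ifs with h <;> simp [h, or_comm]

lemma pair_notMem (h : Hier n F) (c' : ℕ) : {c', n + 2} ∉ F.image (lift1 (n + 2) c) := by
  intro hA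
  obtain ⟨A, hA, e⟩ := Finset.mem_image.mp hA
  have h1 := lift_erase (c := c) (h.notMem hA)
  have h2 := h.two A hA
  rw [e] at h1
  rw [← h1] at h2
  have : ({c', n + 2} : Finset ℕ).erase (n + 2) ⊆ {c'} := by
    intro x; simp only [Finset.mem_erase, Finset.mem_insert, Finset.mem_singleton]; tauto
  have := Finset.card_le_card this
  rw [Finset.card_singleton] at this
  omega

lemma ext_hier (h : Hier n F) (h1 : 1 ≤ c) (hc : c ≤ n + 1) : Hier (n + 1) (extF (n + 2) c F) := by
  have hcm : c ≠ n + 2 := by omega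
  refine ⟨?_, ?_, ?_, ?_, ?_⟩
  · intro A hA x hx
    simp only [extF, Finset.mem_insert, Finset.mem_image] at hA
    rw [Finset.mem_Icc]
    rcases hA with rfl | ⟨A, hA, rfl⟩
    · simp at hx; omega
    · rcases mem_lift.mp hx with hx | hx
      · have := Finset.mem_Icc.mp (h.sub A hA hx); omega
      · omega
  · intro A hA
    simp only [extF, Finset.mem_insert, Finset.mem_image] at hA
    rcases hA with rfl | ⟨A, hA, rfl⟩
    · rw [Finset.card_pair hcm]
    · exact (h.two A hA).trans (Finset.card_le_card fun x hx => mem_lift.mpr (Or.inl hx))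
  · refine Finset.mem_insert_of_mem (Finset.mem_image.mpr ⟨_, h.top, ?_⟩)
    ext x
    rw [mem_lift]
    simp only [Finset.mem_Icc]
    omega
  · have key : ∀ A ∈ F, ({c, n + 2} : Finset ℕ) ⊆ lift1 (n + 2) c A ∨
        Disjoint {c, n + 2} (lift1 (n + 2) c A) := by
      intro A hA
      by_cases hcA : c ∈ A
      · left; intro x hx
        simp only [Finset.mem_insert, Finset.mem_singleton] at hx
        rw [mem_lift]
        rcases hx with rfl | rfl
        · exact Or.inl hcA
        · exact Or.inr ⟨rfl, hcA⟩
      · right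
        rw [Finset.disjoint_left]
        intro x hx hx'
        simp only [Finset.mem_insert, Finset.mem_singleton] at hx
        have := h.notMem hA
        rw [mem_lift] at hx'
        rcases hx with rfl | rfl <;> tauto
    intro A hA B hB
    simp only [extF, Finset.mem_insert, Finset.mem_image] at hA hB
    rcases hA with rfl | ⟨A, hA, rfl⟩ <;> rcases hB with rfl | ⟨B, hB, rfl⟩
    · exact Or.inl (Finset.Subset.refl _)
    · rcases key B hB with h | h <;> tauto
    · rcases key A hA with h | h
      · tauto
      · exact Or.inr (Or.inr h.symm)
    · rcases h.lam A hA B hB with h3 | h3 | h3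
      · left; intro x; simp only [mem_lift]
        exact Or.imp (fun h => h3 h) (fun h => ⟨h.1, h3 h.2⟩)
      · right; left; intro x; simp only [mem_lift]
        exact Or.imp (fun h => h3 h) (fun h => ⟨h.1, h3 h.2⟩)
      · right; right
        have a := h.notMem hA
        have b := h.notMem hB
        rw [Finset.disjoint_left] at h3 ⊢
        intro x hx hx'
        rw [mem_lift] at hx hx'
        rcases hx with hx | ⟨rfl, hx⟩ <;> rcases hx' with hx' | ⟨h5, hx'⟩
        · exact h3 hx hx'
        · exact a (h5 ▸ hx)
        · exact b hx'
        · exact h3 hx hx'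
  · rw [extF, Finset.card_insert_of_notMem (pair_notMem h c), Finset.card_image_of_injOn, h.card]
    intro A hA B hB e
    rw [← lift_erase (c := c) (h.notMem hA), e, lift_erase (h.notMem hB)]

lemma ext_bal (h : Hier n F) (h1 : 1 ≤ c) (hc : c ≤ n + 1) (hb : BalancedFam F) :
    BalancedFam (extF (n + 2) c F) := by
  have h' := ext_hier h h1 hc
  rintro A hA l₁ l₂ hl₁ hl₂ hlt hmin ⟨B, hB, hBA, hB1, hB2⟩
  have hmax : l₂ ≤ n + 2 := by have := Finset.mem_Icc.mp (h'.sub A hA hl₂); omega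
  have hA' := hA
  simp only [extF, Finset.mem_insert, Finset.mem_image] at hA hB
  rcases hA with rfl | ⟨A, hA, rfl⟩
  · have a := Finset.card_lt_card hBA
    have b : 2 ≤ B.card := h'.two B (by simpa [extF] using hB)
    rw [Finset.card_pair (by omega)] at a
    omega
  · have hl₂' : l₂ < n + 2 := by
      obtain ⟨x, hx, y, hy, hxy, -⟩ := two_small (h.two A hA)
      have := Finset.mem_Icc.mp (h.sub A hA hx)
      have := Finset.mem_Icc.mp (h.sub A hA hy)
      rcases hmin x (mem_lift.mpr (Or.inl hx)) with h3 | h3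
      · rcases hmin y (mem_lift.mpr (Or.inl hy)) with h4 | h4 <;> omega
      · omega
    have red : ∀ {C : Finset ℕ} {x : ℕ}, x < n + 2 → x ∈ lift1 (n + 2) c C → x ∈ C := by
      intro C x hx hC
      rcases mem_lift.mp hC with h3 | h3
      · exact h3
      · omega
    rcases hB with rfl | ⟨B, hB, rfl⟩
    · simp at hB1 hB2; omega
    · refine hb A hA l₁ l₂ (red (by omega) hl₁) (red hl₂' hl₂) hlt
        (fun m hm => hmin m (mem_lift.mpr (Or.inl hm)))
        ⟨B, hB, ?_, red (by omega) hB1, red hl₂' hB2⟩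
      rw [Finset.ssubset_iff_subset_ne]
      constructor
      · have := Finset.erase_subset_erase (n + 2) hBA.1
        rwa [lift_erase (h.notMem hA), lift_erase (h.notMem hB)] at this
      · rintro rfl
        exact hBA.2 (Finset.Subset.refl _)

lemma ext_restr (h : Hier n F) :
    restr (n + 2) {c, n + 2} (extF (n + 2) c F) = F := by
  rw [restr, extF, Finset.erase_insert (pair_notMem h c), Finset.image_image]
  conv_rhs => rw [← Finset.image_id (s := F)]
  apply Finset.image_congr
  intro A hA
  exact lift_erase (h.notMem hA)

lemma ext_inj {F' : Finset (Finset ℕ)} {c' : ℕ} (h : Hier n F) (h' : Hier n F')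
    (hc' : c' ≤ n + 1)
    (e : extF (n + 2) c F = extF (n + 2) c' F') : c = c' ∧ F = F' := by
  have hcc : c = c' := by
    have : {c', n + 2} ∈ extF (n + 2) c F := by rw [e]; simp [extF]
    rw [extF, Finset.mem_insert] at this
    rcases this with h3 | h3
    · have : c' ∈ ({c, n + 2} : Finset ℕ) := by rw [← h3]; simp
      simp at this
      omega
    · exact absurd h3 (pair_notMem h c')
  subst hcc
  exact ⟨rfl, by rw [← ext_restr (c := c) h, e, ext_restr h']⟩

lemma ext_surj (hn : 1 ≤ n) (h : Hier (n + 1) F) (hb : BalancedFam F) :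
    ∃ c F', 1 ≤ c ∧ c ≤ n + 1 ∧ Hier n F' ∧ BalancedFam F' ∧ F = extF (n + 2) c F' := by
  obtain ⟨A0, hA0, hm, hmin⟩ := exists_min h.lam (m := n + 2)
    ⟨_, h.top, Finset.mem_Icc.mpr ⟨by omega, by omega⟩⟩
  have hlt : ∀ A ∈ F, ∀ x ∈ A, 1 ≤ x ∧ x ≤ n + 2 := fun A hA x hx =>
    Finset.mem_Icc.mp (h.sub A hA hx)
  have hcard : A0.card = 2 := by
    by_contra hne
    have h3 : 2 ≤ (A0.erase (n + 2)).card := by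
      rw [Finset.card_erase_of_mem hm]
      have := h.two A0 hA0
      omega
    have hss : A0.erase (n + 2) ⊂ A0 := Finset.erase_ssubset hm
    have hnot : A0.erase (n + 2) ∉ F := by
      intro hD
      obtain ⟨x, hx, y, hy, hxy, hs⟩ := two_small h3
      refine hb A0 hA0 x y (hss.1 hx) (hss.1 hy) hxy ?_ ⟨_, hD, hss, hx, hy⟩
      intro z hz
      by_cases e : z = n + 2
      · right; rw [e]; exact (hlt A0 hA0 y (hss.1 hy)).2
      · exact hs z (Finset.mem_erase.mpr ⟨e, hz⟩)
    have key : ∀ B ∈ F, A0.erase (n + 2) ⊆ B ∨ B ⊆ A0.erase (n + 2) ∨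
        Disjoint (A0.erase (n + 2)) B := by
      intro B hB
      by_cases hmB : n + 2 ∈ B
      · exact Or.inl (hss.1.trans (hmin B hB hmB))
      · rcases h.lam A0 hA0 B hB with h4 | h4 | h4
        · exact Or.inl (hss.1.trans h4)
        · exact Or.inr (Or.inl (fun x hx => Finset.mem_erase.mpr
            ⟨fun e => hmB (e ▸ hx), h4 hx⟩))
        · exact Or.inr (Or.inr (Finset.disjoint_of_subset_left hss.1 h4))
    have := lam_bound (n + 1) (insert (A0.erase (n + 2)) F) (by
        intro A hA B hB
        rw [Finset.mem_insert] at hA hB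
        rcases hA with rfl | hA <;> rcases hB with rfl | hB
        · exact Or.inl (Finset.Subset.refl _)
        · exact key B hB
        · rcases key A hA with h | h | h
          · tauto
          · tauto
          · exact Or.inr (Or.inr h.symm)
        · exact h.lam A hA B hB) (by
        intro A hA
        rw [Finset.mem_insert] at hA
        rcases hA with rfl | hA
        · exact h3
        · exact h.two A hA) (by
        intro A hA
        rw [Finset.mem_insert] at hA
        rcases hA with rfl | hA
        · exact hss.1.trans (h.sub A0 hA0)
        · exact h.sub A hA)
    rw [Finset.card_insert_of_notMem hnot, h.card] at this
    omega
  obtain ⟨c, hc⟩ : ∃ c, A0.erase (n + 2) = {c} := Finset.card_eq_one.mp (by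
    rw [Finset.card_erase_of_mem hm, hcard])
  have hA0' : A0 = {c, n + 2} := by
    rw [← Finset.insert_erase hm, hc, Finset.pair_comm]
  have hcm : c ∈ A0.erase (n + 2) := by rw [hc]; simp
  rw [Finset.mem_erase] at hcm
  have hcb := hlt A0 hA0 c hcm.2
  refine ⟨c, restr (n + 2) A0 F, hcb.1, by omega, ⟨?_, ?_, ?_, ?_, ?_⟩, ?_, ?_⟩
  · exact restr_sub (n := n + 1) h.sub A0
  · exact restr_two h.two hA0 hmin
  · refine Finset.mem_image.mpr ⟨_, Finset.mem_erase.mpr ⟨?_, h.top⟩, ?_⟩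
    · intro e
      rw [← e, Nat.card_Icc] at hcard
      omega
    · ext x; simp only [Finset.mem_erase, Finset.mem_Icc]; omega
  · exact restr_lam h.lam _ _
  · rw [restr_card h.lam h.two hA0 hm hmin, h.card]; rfl
  · rintro A hA l₁ l₂ hl₁ hl₂ hl hs ⟨B, hB, hBA, hB1, hB2⟩
    simp only [restr, Finset.mem_image, Finset.mem_erase] at hA hB
    obtain ⟨A, ⟨-, hA⟩, rfl⟩ := hA
    obtain ⟨B, ⟨-, hB⟩, rfl⟩ := hB
    have f := fun (C : Finset ℕ) => Finset.erase_subset (n + 2) C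
    have hnAB : ¬ A ⊆ B := fun h4 => hBA.2 (Finset.erase_subset_erase _ h4)
    refine hb A hA l₁ l₂ (f _ hl₁) (f _ hl₂) hl ?_ ⟨B, hB, ?_, f _ hB1, f _ hB2⟩
    · intro z hz
      by_cases e : z = n + 2
      · right; rw [e]; exact (hlt A hA l₂ (f _ hl₂)).2
      · exact hs z (Finset.mem_erase.mpr ⟨e, hz⟩)
    · rcases lam_cases h.lam hA hB (f _ hl₁) (f _ hB1) with h4 | h4
      · exact absurd h4 hnAB
      · exact ⟨h4, hnAB⟩
  · have hl : ∀ A ∈ F.erase A0, lift1 (n + 2) c (A.erase (n + 2)) = A := by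
      intro A hA
      rw [Finset.mem_erase] at hA
      have hiff : c ∈ A.erase (n + 2) ↔ n + 2 ∈ A := by
        rw [Finset.mem_erase]
        constructor
        · rintro ⟨-, hcA⟩
          rcases lam_cases h.lam hA.2 hA0 hcA hcm.2 with h4 | h4
          · exact absurd (Finset.eq_of_subset_of_card_le h4 (by rw [hcard]; exact h.two A hA.2)) hA.1
          · exact h4 hm
        · intro hmA
          exact ⟨hcm.1, hmin A hA.2 hmA hcm.2⟩
      unfold lift1
      split_ifs with h5
      · exact Finset.insert_erase (hiff.mp h5)
      · exact Finset.erase_eq_of_notMem (fun h6 => h5 (hiff.mpr h6))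
    rw [extF, restr, Finset.image_image, ← hA0']
    have : (F.erase A0).image (lift1 (n + 2) c ∘ fun A => A.erase (n + 2)) = F.erase A0 := by
      conv_rhs => rw [← Finset.image_id (s := F.erase A0)]
      exact Finset.image_congr (fun A hA => hl A hA)
    rw [this, Finset.insert_erase hA0]

end ext

lemma main_aux (n : ℕ) :
    (∀ k ∈ KSet (n + 1 + 2), Hier (n + 1) (treeFam (n + 1 + 2) k) ∧
      BalancedFam (treeFam (n + 1 + 2) k)) ∧
    Set.InjOn (treeFam (n + 1 + 2)) (KSet (n + 1 + 2)) ∧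
    ∀ F, Hier (n + 1) F → BalancedFam F → ∃ k ∈ KSet (n + 1 + 2), treeFam (n + 1 + 2) k = F := by
  induction n with
  | zero =>
    have hk1 : ∀ k ∈ KSet (0 + 1 + 2), k = fun i => if i = 1 then 1 else 0 := by
      rintro k ⟨a, b⟩
      funext i
      have := a 1 (by omega) (by omega)
      split_ifs with hi
      · subst hi; omega
      · exact b i (by omega)
    have ht : ∀ k ∈ KSet (0 + 1 + 2), treeFam (0 + 1 + 2) k = {Finset.Icc 1 2} := by
      intro k hk
      rw [hk1 k hk]
      decide
    have hH : Hier 1 {Finset.Icc 1 2} := by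
      refine ⟨by simp, by simp, by simp, ?_, by simp⟩
      intro A hA B hB
      rw [Finset.mem_singleton] at hA hB
      subst hA; subst hB
      exact Or.inl (Finset.Subset.refl _)
    refine ⟨fun k hk => ?_, fun k hk l hl _ => by rw [hk1 k hk, hk1 l hl], fun F hF _ => ?_⟩
    · rw [ht k hk]
      refine ⟨hH, ?_⟩
      rintro A hA l₁ l₂ - - - - ⟨B, hB, hBA, -⟩
      rw [Finset.mem_singleton] at hA hB
      subst hA; subst hB
      exact hBA.2 (Finset.Subset.refl _)
    · have hk : (fun i => if i = 1 then 1 else 0) ∈ KSet (0 + 1 + 2) := by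
        constructor
        · intro i h1 h2
          have : i = 1 := by omega
          simp [this]
        · intro i hi
          have : i ≠ 1 := by omega
          simp [this]
      refine ⟨_, hk, ?_⟩
      rw [ht _ hk]
      obtain ⟨A, rfl⟩ := Finset.card_eq_one.mp hF.card
      rw [Finset.mem_singleton.mp hF.top]
  | succ n ih =>
    obtain ⟨i1, i2, i3⟩ := ih
    have tr : ∀ k ∈ KSet (n + 1 + 1 + 2), ∃ k' ∈ KSet (n + 1 + 2), (∀ i ≤ n + 1, k i = k' i) ∧
        treeFam (n + 1 + 2) k = treeFam (n + 1 + 2) k' := by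
      rintro k ⟨a, b⟩
      refine ⟨fun i => if i ≤ n + 1 then k i else 0, ⟨?_, ?_⟩, ?_, ?_⟩
      · intro i h1 h2
        have : i ≤ n + 1 := by omega
        simpa only [this, if_true] using a i h1 (by omega)
      · intro i hi
        by_cases h0 : i ≤ n + 1
        · simpa only [h0, if_true] using b i (by omega)
        · simp only [h0, if_false]
      · intro i hi; simp [hi]
      · exact treeFam_congr _ (fun i hi => by simp [hi])
    have hkb : ∀ k ∈ KSet (n + 1 + 1 + 2), 1 ≤ k (n + 1 + 1) ∧ k (n + 1 + 1) ≤ n + 1 + 1 :=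
      fun k hk => hk.1 _ (by omega) (by omega)
    have hH : ∀ k ∈ KSet (n + 1 + 1 + 2), Hier (n + 1) (treeFam (n + 1 + 2) k) ∧
        BalancedFam (treeFam (n + 1 + 2) k) := by
      intro k hk
      obtain ⟨k', hk', -, e⟩ := tr k hk
      rw [e]; exact i1 k' hk'
    refine ⟨fun k hk => ?_, fun k hk l hl e => ?_, fun F hF hb => ?_⟩
    · rw [treeFam_succ]
      exact ⟨ext_hier (hH k hk).1 (hkb k hk).1 (hkb k hk).2,
        ext_bal (hH k hk).1 (hkb k hk).1 (hkb k hk).2 (hH k hk).2⟩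
    · rw [treeFam_succ (n + 1) k, treeFam_succ (n + 1) l] at e
      obtain ⟨e1, e2⟩ := ext_inj (hH k hk).1 (hH l hl).1 (hkb l hl).2 e
      obtain ⟨k', hk', ek, ek'⟩ := tr k hk
      obtain ⟨l', hl', el, el'⟩ := tr l hl
      have : k' = l' := i2 hk' hl' (by rw [← ek', e2, el'])
      funext i
      rcases lt_trichotomy i (n + 1 + 1) with h | h | h
      · rw [ek i (by omega), el i (by omega), this]
      · rw [h, e1]
      · rw [hk.2 i (by omega), hl.2 i (by omega)]
    · obtain ⟨c, F', c1, c2, hF', hb', rfl⟩ := ext_surj (by omega) hF hb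
      obtain ⟨k', hk', rfl⟩ := i3 F' hF' hb'
      refine ⟨Function.update k' (n + 1 + 1) c, ⟨?_, ?_⟩, ?_⟩
      · intro i h1 h2
        by_cases h : i = n + 1 + 1
        · subst h; simp only [Function.update_self]; exact ⟨c1, c2⟩
        · rw [Function.update_of_ne h]; exact hk'.1 i h1 (by omega)
      · intro i hi
        rw [Function.update_of_ne (by omega)]
        exact hk'.2 i (by omega)
      · rw [treeFam_succ, Function.update_self, treeFam_congr (l := k')]
        intro i hi
        rw [Function.update_of_ne (by omega)]

theorem stmt2 (g : ℕ) (hg : 3 ≤ g) :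
    (∀ k ∈ KSet g, IsHier g (treeFam g k) ∧ BalancedFam (treeFam g k)) ∧
    Set.BijOn (treeFam g) (KSet g) {F : Finset (Finset ℕ) | IsHier g F ∧ BalancedFam F} := by
  obtain ⟨n, rfl⟩ : ∃ n, g = n + 1 + 2 := ⟨g - 3, by omega⟩
  obtain ⟨h1, h2, h3⟩ := main_aux n
  have h4 : ∀ k ∈ KSet (n + 1 + 2), IsHier (n + 1 + 2) (treeFam (n + 1 + 2) k) ∧
      BalancedFam (treeFam (n + 1 + 2) k) :=
    fun k hk => ⟨(hier_iff _ _).mpr (h1 k hk).1, (h1 k hk).2⟩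
  exact ⟨h4, h4, h2, fun F hF => h3 F ((hier_iff _ _).mp hF.1) hF.2⟩
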